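/- arXiv:1310.5384 — 2 statements merged into one kernel-verified Lean document; each statement's English description precedes it below -/
import Mathlib

section
/- Let h be a smooth function on ℝ², let M = {(x, h(x)) : x ∈ ℝ²}, and let Ω̃ ⊂ ℝ² be star-shaped with respect to a point õ ∈ Ω̃. Then for a function u on Ω̃ there exist functions u₁, u₂ such that V = (u₁, u₂, u) is an infinitesimal isometry on Ω = {(x,h(x)) : x ∈ Ω̃} if and only if u solves div(A(x)∇u) = 0 on Ω̃, where A(x) is the 2×2 matrix with rows (h_{x₂x₂}, −h_{x₁x₂}) and (−h_{x₁x₂}, h_{x₁x₁}), and div, ∇ are the Euclidean divergence and gradient of ℝ². -/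
noncomputable section

open RealInnerProductSpace

/-- Points of the plane `ℝ²`. -/
abbrev E2 := EuclideanSpace ℝ (Fin 2)

/-- Points of the ambient space `ℝ³`. -/
abbrev E3 := EuclideanSpace ℝ (Fin 3)

/-- The point `(a,b,c) ∈ ℝ³`. -/
def mk3 (a b c : ℝ) : E3 := (EuclideanSpace.equiv (Fin 3) ℝ).symm ![a, b, c]

/-- The Euclidean partial derivative `∂φ/∂x_i`. -/
def pd (i : Fin 2) (φ : E2 → ℝ) (x : E2) : ℝ := fderiv ℝ φ x (EuclideanSpace.single i 1)

/-- `V = (u₁,u₂,u)` is an infinitesimal isometry of the graph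
`Ω = {(x,h(x)) : x ∈ Ω̃}`: for every `x ∈ Ω̃` and every tangent vector
`(α, ∇h·α)` of the graph, `⟨D̂_X V, X⟩ = 0`. -/
def IsGraphInfIsom (h : E2 → ℝ) (Ωt : Set E2) (u₁ u₂ u : E2 → ℝ) : Prop :=
  ∀ x ∈ Ωt,
    DifferentiableAt ℝ (fun y => mk3 (u₁ y) (u₂ y) (u y)) x ∧
    ∀ a : E2, ⟪fderiv ℝ (fun y => mk3 (u₁ y) (u₂ y) (u y)) x a,
        mk3 (a 0) (a 1) (fderiv ℝ h x a)⟫ = 0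

/-- Poincaré lemma: a closed `1`-form on an open star-shaped set has a primitive. -/
theorem StarConvex.exists_forall_hasFDerivAt_of_symmetric {E : Type*}
    [NormedAddCommGroup E] [NormedSpace ℝ E] {U : Set E} {o : E}
    (hU : IsOpen U) (hs : StarConvex ℝ o U) {ω : E → E →L[ℝ] ℝ}
    {dω : E → E →L[ℝ] E →L[ℝ] ℝ} (hω : ∀ x ∈ U, HasFDerivAt ω (dω x) x)
    (hsymm : ∀ x ∈ U, ∀ v w, dω x v w = dω x w v) :
    ∃ F : E → ℝ, ∀ x ∈ U, HasFDerivAt F (ω x) x := by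
  refine ⟨fun b => curveIntegral ω (Path.segment o b), fun b hb => ?_⟩
  obtain ⟨r, hr, hball⟩ := Metric.isOpen_iff.1 hU b hb
  have hsub : convexJoin ℝ {o} (Metric.ball b r) ⊆ U := by
    rw [convexJoin_singleton_left]
    exact Set.iUnion₂_subset fun y hy => hs.segment_subset (hball hy)
  have hmem : Metric.ball b r ⊆ convexJoin ℝ {o} (Metric.ball b r) :=
    subset_convexJoin_right (Set.singleton_nonempty o)
  have hconv : Convex ℝ (convexJoin ℝ {o} (Metric.ball b r)) :=
    (convex_singleton o).convexJoin (convex_ball b r)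
  have hob : o ∈ convexJoin ℝ {o} (Metric.ball b r) :=
    subset_convexJoin_left ⟨b, Metric.mem_ball_self hr⟩ rfl
  exact (hconv.hasFDerivWithinAt_curveIntegral_segment_of_hasFDerivWithinAt_symmetric
    (fun x hx => (hω x (hsub hx)).hasFDerivWithinAt)
    (fun a ha v _ w _ => hsymm a (hsub ha) v w) hob
    (hmem (Metric.mem_ball_self hr))).hasFDerivAt
    (Filter.mem_of_superset (Metric.ball_mem_nhds b hr) hmem)

open Topology Filter in
/-- If `v` has directional derivatives `p` along `e` and `q` along `d` on an open set, and `p` is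
strictly differentiable at `x`, then `q` is differentiable along `e` at `x` and the mixed
derivatives agree. -/
theorem hasLineDerivAt_swap {E : Type*} [NormedAddCommGroup E] [NormedSpace ℝ E] {U : Set E}
    (hU : IsOpen U) {v p q : E → ℝ} {e d x : E} (hx : x ∈ U)
    (hp : ∀ y ∈ U, HasLineDerivAt ℝ v (p y) y e) (hq : ∀ y ∈ U, HasLineDerivAt ℝ v (q y) y d)
    {p' : E →L[ℝ] ℝ} (hp' : HasStrictFDerivAt p p' x) :
    HasLineDerivAt ℝ q (p' d) x e := by
  have key : ∀ (y : E) (w : E → ℝ), (∀ z ∈ U, HasLineDerivAt ℝ v (w z) z y) → ∀ (z : E) (t : ℝ), z + t • y ∈ U →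
      HasDerivAt (fun s : ℝ => v (z + s • y)) (w (z + t • y)) t := by
    intro y w hw z t hz
    have h1 : HasDerivAt (fun s : ℝ => v (z + t • y + s • y)) (w (z + t • y)) (t - t) := by
      rw [sub_self]; exact hw _ hz
    have h2 := h1.comp_sub_const t t
    refine h2.congr_of_eventuallyEq (Eventually.of_forall fun s => ?_)
    simp only [sub_smul]
    congr 1
    abel
  unfold HasLineDerivAt
  rw [hasDerivAt_iff_isLittleO, Asymptotics.isLittleO_iff]
  intro ε hε
  have hc : 0 < ε / (‖d‖ + 1) := by positivity
  have hev := (Asymptotics.isLittleO_iff.1 hp'.isLittleO) hc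
  have hUx : ∀ᶠ z : E × E in 𝓝 (x, x), z.1 ∈ U ∧ z.2 ∈ U :=
    (hU.prod hU).mem_nhds ⟨hx, hx⟩
  have htend : Tendsto (fun a : ℝ × ℝ => (x + a.1 • e + a.2 • d, x + a.1 • e)) (𝓝 (0, 0))
      (𝓝 (x, x)) := by
    have : Continuous (fun a : ℝ × ℝ => (x + a.1 • e + a.2 • d, x + a.1 • e)) := by fun_prop
    simpa using this.tendsto (0, 0)
  obtain ⟨η, hη, hball⟩ := Metric.eventually_nhds_iff_ball.1 (htend.eventually (hev.and hUx))
  have hin : ∀ t s : ℝ, t ∈ Metric.ball (0 : ℝ) η → s ∈ Metric.ball (0 : ℝ) η →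
      ((t, s) : ℝ × ℝ) ∈ Metric.ball ((0, 0) : ℝ × ℝ) η := fun t s ht hs => by
    rw [← ball_prod_same]; exact ⟨ht, hs⟩
  filter_upwards [Metric.ball_mem_nhds (0 : ℝ) hη] with t ht
  have h0 : (0 : ℝ) ∈ Metric.ball (0 : ℝ) η := Metric.mem_ball_self hη
  set G : ℝ → ℝ := fun s =>
    (v (x + t • e + s • d) - v (x + s • d)) - (v (x + t • e) - v x) - t * (s * p' d) with hG
  have hbound : ∀ s ∈ Metric.ball (0 : ℝ) η, ‖G s - G 0‖ ≤ (ε * ‖t‖) * ‖s - 0‖ := by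
    intro s hs
    have hder : ∀ τ ∈ Metric.ball (0 : ℝ) η, HasDerivWithinAt
        (fun τ : ℝ => v (x + s • d + τ • e) - v (x + τ • e) - τ * (s * p' d))
        (p (x + s • d + τ • e) - p (x + τ • e) - 1 * (s * p' d)) (Metric.ball 0 η) τ := by
      intro τ hτ
      have hU2 := (hball _ (hin τ s hτ hs)).2
      simp only [] at hU2
      rw [add_right_comm] at hU2
      exact (((key e p hp _ _ hU2.1).sub (key e p hp _ _ hU2.2)).sub
        ((hasDerivAt_id τ).mul_const _)).hasDerivWithinAt
    have hle : ∀ τ ∈ Metric.ball (0 : ℝ) η,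
        ‖p (x + s • d + τ • e) - p (x + τ • e) - 1 * (s * p' d)‖ ≤ ε * ‖s‖ := by
      intro τ hτ
      have h1 := (hball _ (hin τ s hτ hs)).1
      simp only [add_sub_cancel_left, map_smul, smul_eq_mul, norm_smul] at h1
      rw [add_right_comm, one_mul]
      refine h1.trans ?_
      rw [div_mul_eq_mul_div, div_le_iff₀ (by positivity)]
      have : 0 ≤ ε * ‖s‖ := by positivity
      nlinarith
    have := (convex_ball (0 : ℝ) η).norm_image_sub_le_of_norm_hasDerivWithin_le hder hle h0 ht
    simp only [zero_smul, add_zero, zero_mul, sub_zero] at this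
    simp only [hG, zero_smul, add_zero, zero_mul, mul_zero, sub_zero, sub_self]
    calc _ = _ := by rw [add_right_comm]; congr 1; ring
      _ ≤ _ := this
      _ = _ := by ring
  have hGd : HasDerivAt G (q (x + t • e) - q x - t * (1 * p' d)) 0 := by
    have hU2 := (hball _ (hin t 0 ht h0)).2.2
    simp only [] at hU2
    exact (((hq _ hU2).sub (hq _ hx)).sub_const _).sub
      (((hasDerivAt_id (0 : ℝ)).mul_const _).const_mul t)
  have := hGd.le_of_lip' (by positivity)
    (Filter.mem_of_superset (Metric.ball_mem_nhds 0 hη) hbound)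
  simpa using this

theorem contDiff_pd {φ : E2 → ℝ} (hφ : ContDiff ℝ (⊤ : ℕ∞) φ) (i : Fin 2) :
    ContDiff ℝ (⊤ : ℕ∞) (pd i φ) := by
  have : ContDiff ℝ (⊤ : ℕ∞) (fderiv ℝ φ) := hφ.fderiv_right (by simp)
  exact this.clm_apply contDiff_const

theorem pd_mul {φ ψ : E2 → ℝ} (hφ : ContDiff ℝ (⊤ : ℕ∞) φ) (hψ : ContDiff ℝ (⊤ : ℕ∞) ψ)
    (i : Fin 2) :
    pd i (fun y => φ y * ψ y) = fun y => pd i φ y * ψ y + φ y * pd i ψ y := by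
  funext x
  have h1 := (hφ.differentiable (by simp)) x
  have h2 := (hψ.differentiable (by simp)) x
  simp only [pd, fderiv_fun_mul h1 h2]
  simp
  ring

theorem pd_add {φ ψ : E2 → ℝ} (hφ : ContDiff ℝ (⊤ : ℕ∞) φ) (hψ : ContDiff ℝ (⊤ : ℕ∞) ψ)
    (i : Fin 2) : pd i (fun y => φ y + ψ y) = fun y => pd i φ y + pd i ψ y := by
  funext x
  have h1 := (hφ.differentiable (by simp)) x
  have h2 := (hψ.differentiable (by simp)) x
  simp [pd, fderiv_fun_add h1 h2]

theorem pd_sub {φ ψ : E2 → ℝ} (hφ : ContDiff ℝ (⊤ : ℕ∞) φ) (hψ : ContDiff ℝ (⊤ : ℕ∞) ψ)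
    (i : Fin 2) : pd i (fun y => φ y - ψ y) = fun y => pd i φ y - pd i ψ y := by
  funext x
  have h1 := (hφ.differentiable (by simp)) x
  have h2 := (hψ.differentiable (by simp)) x
  simp [pd, fderiv_fun_sub h1 h2]

theorem pd_neg (φ : E2 → ℝ) (i : Fin 2) : pd i (fun y => -φ y) = fun y => -pd i φ y := by
  funext x
  simp [pd, fderiv_fun_neg]

theorem pd_comm {φ : E2 → ℝ} (hφ : ContDiff ℝ (⊤ : ℕ∞) φ) (i j : Fin 2) :
    pd i (pd j φ) = pd j (pd i φ) := by
  funext x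
  have hd : DifferentiableAt ℝ (fderiv ℝ φ) x :=
    ((hφ.fderiv_right (m := (⊤ : ℕ∞)) (by simp)).differentiable (by simp)) x
  have hs : IsSymmSndFDerivAt ℝ φ x :=
    hφ.contDiffAt.isSymmSndFDerivAt (by simpa using WithTop.coe_le_coe.2 (le_top : (2 : ℕ∞) ≤ ⊤))
  have h (i j : Fin 2) : pd i (pd j φ) x = fderiv ℝ (fderiv ℝ φ) x (EuclideanSpace.single i 1)
      (EuclideanSpace.single j 1) := by
    unfold pd
    rw [fderiv_clm_apply hd (by fun_prop)]
    simp
  rw [h, h]; exact hs _ _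

/-- `div (A ∇u)`, with `A` the cofactor matrix of the Hessian of `h`, is the Saint-Venant
expression of the symmetric part of `-∇u ⊗ ∇h`. -/
theorem div_cofactor_hessian_eq {h u : E2 → ℝ}
    (hh : ContDiff ℝ (⊤ : ℕ∞) h) (hu : ContDiff ℝ (⊤ : ℕ∞) u) (x : E2) :
    pd 0 (fun y => pd 1 (pd 1 h) y * pd 0 u y - pd 0 (pd 1 h) y * pd 1 u y) x +
      pd 1 (fun y => -(pd 0 (pd 1 h) y * pd 0 u y) + pd 0 (pd 0 h) y * pd 1 u y) x
    = pd 1 (pd 1 (fun y => -(pd 0 u y * pd 0 h y))) x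
      + pd 0 (pd 0 (fun y => -(pd 1 u y * pd 1 h y))) x
      - pd 1 (pd 0 (fun y => -(pd 0 u y * pd 1 h y + pd 1 u y * pd 0 h y))) x := by
  have c := @contDiff_pd
  have m {φ ψ : E2 → ℝ} (hφ : ContDiff ℝ (⊤ : ℕ∞) φ) (hψ : ContDiff ℝ (⊤ : ℕ∞) ψ) :
    ContDiff ℝ (⊤ : ℕ∞) (fun y => φ y * ψ y) := hφ.mul hψ
  have a {φ ψ : E2 → ℝ} (hφ : ContDiff ℝ (⊤ : ℕ∞) φ) (hψ : ContDiff ℝ (⊤ : ℕ∞) ψ) :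
    ContDiff ℝ (⊤ : ℕ∞) (fun y => φ y + ψ y) := hφ.add hψ
  have n {φ : E2 → ℝ} (hφ : ContDiff ℝ (⊤ : ℕ∞) φ) :
    ContDiff ℝ (⊤ : ℕ∞) (fun y => -φ y) := hφ.neg
  have h1 {φ : E2 → ℝ} (hφ : ContDiff ℝ (⊤ : ℕ∞) φ) := pd_comm hφ 1 0
  simp (maxDischargeDepth := 10) only [pd_mul, pd_add, pd_sub, pd_neg, h1, c, m, a, n, hh, hu]
  ring

theorem fderiv_eq_pd (φ : E2 → ℝ) (x a : E2) :
    fderiv ℝ φ x a = a 0 * pd 0 φ x + a 1 * pd 1 φ x := by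
  have : a = a 0 • EuclideanSpace.single 0 1 + a 1 • EuclideanSpace.single 1 1 := by
    ext i; fin_cases i <;> simp
  conv_lhs => rw [this]
  simp [pd]

theorem isGraphInfIsom_iff {h u u₁ u₂ : E2 → ℝ} {Ωt : Set E2} (hu : ContDiff ℝ (⊤ : ℕ∞) u) :
    IsGraphInfIsom h Ωt u₁ u₂ u ↔ ∀ x ∈ Ωt,
      DifferentiableAt ℝ u₁ x ∧ DifferentiableAt ℝ u₂ x ∧
      pd 0 u₁ x = -(pd 0 u x * pd 0 h x) ∧ pd 1 u₂ x = -(pd 1 u x * pd 1 h x) ∧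
      pd 1 u₁ x + pd 0 u₂ x = -(pd 0 u x * pd 1 h x + pd 1 u x * pd 0 h x) := by
  refine forall₂_congr fun x _ => ?_
  have hux : DifferentiableAt ℝ u x := (hu.differentiable (by simp)) x
  have hdiff : DifferentiableAt ℝ (fun y => mk3 (u₁ y) (u₂ y) (u y)) x ↔
      DifferentiableAt ℝ u₁ x ∧ DifferentiableAt ℝ u₂ x := by
    rw [differentiableAt_euclidean, Fin.forall_fin_succ, Fin.forall_fin_two]
    simp [mk3, hux]
  rw [hdiff, and_assoc]
  refine and_congr_right fun h1 => and_congr_right fun h2 => ?_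
  have hd : HasFDerivAt (fun y => mk3 (u₁ y) (u₂ y) (u y))
      ((EuclideanSpace.equiv (Fin 3) ℝ).symm.toContinuousLinearMap ∘L
        ContinuousLinearMap.pi ![fderiv ℝ u₁ x, fderiv ℝ u₂ x, fderiv ℝ u x]) x := by
    refine (EuclideanSpace.equiv (Fin 3) ℝ).symm.toContinuousLinearMap.hasFDerivAt.comp x
      (hasFDerivAt_pi.2 fun i => ?_)
    fin_cases i
    · exact h1.hasFDerivAt
    · exact h2.hasFDerivAt
    · exact hux.hasFDerivAt
  have hin : ∀ a : E2, inner ℝ (fderiv ℝ (fun y => mk3 (u₁ y) (u₂ y) (u y)) x a)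
      (mk3 (a 0) (a 1) (fderiv ℝ h x a)) =
      fderiv ℝ u₁ x a * a 0 + fderiv ℝ u₂ x a * a 1 + fderiv ℝ u x a * fderiv ℝ h x a := by
    intro a
    rw [hd.fderiv, PiLp.inner_apply, Fin.sum_univ_three]
    simp [mk3]
    ring
  simp only [hin]
  simp only [fderiv_eq_pd u₁, fderiv_eq_pd u₂, fderiv_eq_pd u, fderiv_eq_pd h]
  constructor
  · intro H
    have e0 := H (EuclideanSpace.single 0 1)
    have e1 := H (EuclideanSpace.single 1 1)
    have e2 := H (EuclideanSpace.single 0 1 + EuclideanSpace.single 1 1)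
    simp at e0 e1 e2
    refine ⟨by linarith, by linarith, by linarith⟩
  · rintro ⟨e0, e1, e2⟩ a
    linear_combination (a 0) ^ 2 * e0 + (a 1) ^ 2 * e1 + a 0 * a 1 * e2

theorem StarConvex.exists_pd_eq {U : Set E2} {o : E2} (hU : IsOpen U)
    (hs : StarConvex ℝ o U) {p q : E2 → ℝ}
    (hp : ∀ x ∈ U, DifferentiableAt ℝ p x) (hq : ∀ x ∈ U, DifferentiableAt ℝ q x)
    (hpq : ∀ x ∈ U, pd 1 p x = pd 0 q x) :
    ∃ F : E2 → ℝ, ∀ x ∈ U, DifferentiableAt ℝ F x ∧ pd 0 F x = p x ∧ pd 1 F x = q x := by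
  let π (i : Fin 2) : E2 →L[ℝ] ℝ := EuclideanSpace.proj i
  obtain ⟨F, hF⟩ := StarConvex.exists_forall_hasFDerivAt_of_symmetric hU hs (ω := fun x => p x • π 0 + q x • π 1)
    (dω := fun x => (fderiv ℝ p x).smulRight (π 0) + (fderiv ℝ q x).smulRight (π 1))
    (fun x hx => ((hp x hx).hasFDerivAt.smul_const (π 0)).add ((hq x hx).hasFDerivAt.smul_const (π 1)))
    (fun x hx v w => by
      simp [π, fderiv_eq_pd]
      linear_combination (v 1 * w 0 - v 0 * w 1) * hpq x hx)
  refine ⟨F, fun x hx => ⟨(hF x hx).differentiableAt, ?_, ?_⟩⟩ <;>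
  simp [pd, (hF x hx).fderiv, π]

theorem hasLineDerivAt_pd {φ : E2 → ℝ} {x : E2} (hφ : DifferentiableAt ℝ φ x) (i : Fin 2) :
    HasLineDerivAt ℝ φ (pd i φ x) x (EuclideanSpace.single i 1) :=
  hφ.hasFDerivAt.hasLineDerivAt _

/-- Saint-Venant compatibility for a field `(u₁, u₂)` that is merely differentiable, but whose
symmetrized gradient is smooth. -/
theorem compatibility_of_symmetric_gradient {U : Set E2} (hU : IsOpen U) {u₁ u₂ f g k : E2 → ℝ}
    (hf : ContDiff ℝ (⊤ : ℕ∞) f) (hg : ContDiff ℝ (⊤ : ℕ∞) g) (hk : ContDiff ℝ (⊤ : ℕ∞) k)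
    (h₁ : ∀ x ∈ U, DifferentiableAt ℝ u₁ x) (h₂ : ∀ x ∈ U, DifferentiableAt ℝ u₂ x)
    (h₁f : ∀ x ∈ U, pd 0 u₁ x = f x) (h₂g : ∀ x ∈ U, pd 1 u₂ x = g x)
    (hsum : ∀ x ∈ U, pd 1 u₁ x + pd 0 u₂ x = k x) {x : E2} (hx : x ∈ U) :
    pd 1 (pd 1 f) x + pd 0 (pd 0 g) x - pd 1 (pd 0 k) x = 0 := by
  have strict {φ : E2 → ℝ} (hφ : ContDiff ℝ (⊤ : ℕ∞) φ) (y : E2) :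
      HasStrictFDerivAt φ (fderiv ℝ φ y) y := hφ.contDiffAt.hasStrictFDerivAt (by simp)
  have diff {φ : E2 → ℝ} (hφ : ContDiff ℝ (⊤ : ℕ∞) φ) (y : E2) : DifferentiableAt ℝ φ y :=
    (hφ.differentiable (by simp)) y
  have a1 : ∀ y ∈ U, HasLineDerivAt ℝ (pd 1 u₁) (pd 1 f y) y (EuclideanSpace.single 0 1) :=
    fun y hy => hasLineDerivAt_swap hU hy (fun z hz => h₁f z hz ▸ hasLineDerivAt_pd (h₁ z hz) 0)
      (fun z hz => hasLineDerivAt_pd (h₁ z hz) 1) (strict hf y)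
  have a2 : ∀ y ∈ U, HasLineDerivAt ℝ (pd 0 u₂) (pd 0 g y) y (EuclideanSpace.single 1 1) :=
    fun y hy => hasLineDerivAt_swap hU hy (fun z hz => h₂g z hz ▸ hasLineDerivAt_pd (h₂ z hz) 1)
      (fun z hz => hasLineDerivAt_pd (h₂ z hz) 0) (strict hg y)
  have a3 : ∀ y ∈ U, HasLineDerivAt ℝ (pd 0 u₂) (pd 0 k y - pd 1 f y) y
      (EuclideanSpace.single 0 1) := fun y hy => by
    have hd : HasLineDerivAt ℝ (fun z => k z - pd 1 u₁ z) (pd 0 k y - pd 1 f y) y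
        (EuclideanSpace.single 0 1) := HasDerivAt.sub (hasLineDerivAt_pd (diff hk y) 0) (a1 y hy)
    refine hd.congr_of_eventuallyEq ?_
    filter_upwards [hU.mem_nhds hy] with z hz
    linarith [hsum z hz]
  have a4 := hasLineDerivAt_swap hU hx a2 a3 (strict (contDiff_pd hg 0) x)
  have a5 : HasLineDerivAt ℝ (fun y => pd 0 k y - pd 1 f y) (pd 1 (pd 0 k) x - pd 1 (pd 1 f) x) x
      (EuclideanSpace.single 1 1) :=
    HasDerivAt.sub (hasLineDerivAt_pd (diff (contDiff_pd hk 0) x) 1)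
      (hasLineDerivAt_pd (diff (contDiff_pd hf 1) x) 1)
  have := a4.unique a5
  change pd 0 (pd 0 g) x = _ at this
  linarith

/-- On a star-shaped set, the compatibility condition is sufficient for a symmetric tensor field
to be a symmetrized gradient. -/
theorem exists_symmetric_gradient_eq {U : Set E2} {o : E2} (hU : IsOpen U) (hs : StarConvex ℝ o U)
    {f g k : E2 → ℝ}
    (hf : ContDiff ℝ (⊤ : ℕ∞) f) (hg : ContDiff ℝ (⊤ : ℕ∞) g) (hk : ContDiff ℝ (⊤ : ℕ∞) k)
    (H : ∀ x ∈ U, pd 1 (pd 1 f) x + pd 0 (pd 0 g) x - pd 1 (pd 0 k) x = 0) :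
    ∃ u₁ u₂ : E2 → ℝ, ∀ x ∈ U, DifferentiableAt ℝ u₁ x ∧ DifferentiableAt ℝ u₂ x ∧
      pd 0 u₁ x = f x ∧ pd 1 u₂ x = g x ∧ pd 1 u₁ x + pd 0 u₂ x = k x := by
  have diff {φ : E2 → ℝ} (hφ : ContDiff ℝ (⊤ : ℕ∞) φ) (y : E2) : DifferentiableAt ℝ φ y :=
    (hφ.differentiable (by simp)) y
  have dadd {φ ψ : E2 → ℝ} {x : E2} (hφ : DifferentiableAt ℝ φ x) (hψ : DifferentiableAt ℝ ψ x)
      (a b : ℝ) (i : Fin 2) :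
      pd i (fun y => a * φ y + b * ψ y) x = a * pd i φ x + b * pd i ψ x := by
    unfold pd
    rw [fderiv_fun_add (hφ.const_mul a) (hψ.const_mul b), fderiv_const_mul hφ,
      fderiv_const_mul hψ]
    simp
  have lin {φ ψ : E2 → ℝ} {x : E2} (hφ : DifferentiableAt ℝ φ x) (hψ : DifferentiableAt ℝ ψ x)
      (a b : ℝ) : DifferentiableAt ℝ (fun y => a * φ y + b * ψ y) x :=
    (hφ.const_mul a).add (hψ.const_mul b)
  have f1 := contDiff_pd hf 1
  have g0 := contDiff_pd hg 0
  have k0 := contDiff_pd hk 0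
  have k1 := contDiff_pd hk 1
  obtain ⟨r, hr⟩ := StarConvex.exists_pd_eq hU hs (p := fun y => 1 * pd 1 f y + (-1 / 2) * pd 0 k y)
    (q := fun y => (1 / 2) * pd 1 k y + (-1) * pd 0 g y)
    (fun x _ => lin (diff f1 x) (diff k0 x) _ _) (fun x _ => lin (diff k1 x) (diff g0 x) _ _)
    (fun x hx => by
      rw [dadd (diff f1 x) (diff k0 x), dadd (diff k1 x) (diff g0 x), pd_comm hk 0 1]
      linarith [H x hx])
  obtain ⟨u₁, h₁⟩ := StarConvex.exists_pd_eq hU hs (p := f) (q := fun y => (1 / 2) * k y + 1 * r y)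
    (fun x _ => diff hf x) (fun x hx => lin (diff hk x) (hr x hx).1 _ _)
    (fun x hx => by
      rw [dadd (diff hk x) (hr x hx).1, (hr x hx).2.1]
      ring)
  obtain ⟨u₂, h₂⟩ := StarConvex.exists_pd_eq hU hs (p := fun y => (1 / 2) * k y + (-1) * r y) (q := g)
    (fun x hx => lin (diff hk x) (hr x hx).1 _ _) (fun x _ => diff hg x)
    (fun x hx => by
      rw [dadd (diff hk x) (hr x hx).1, (hr x hx).2.2]
      ring)
  refine ⟨u₁, u₂, fun x hx => ⟨(h₁ x hx).1, (h₂ x hx).1, (h₁ x hx).2.1, (h₂ x hx).2.2, ?_⟩⟩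
  rw [(h₁ x hx).2.2, (h₂ x hx).2.1]
  ring

/-- Let `M = {(x,h(x))}` be a graph surface and let
`Ω̃ ⊂ ℝ²` be open and star-shaped with respect to `o₀ ∈ Ω̃`. Then there are
functions `u₁, u₂` such that `V = (u₁,u₂,u)` is an infinitesimal isometry on
`Ω = {(x,h(x)) : x ∈ Ω̃}` iff `u` solves `div(A(x)∇u) = 0` on `Ω̃`, where
`A = [[h_{x₂x₂}, −h_{x₁x₂}], [−h_{x₁x₂}, h_{x₁x₁}]]`. -/
theorem statement_9 (h : E2 → ℝ) (hh : ContDiff ℝ (⊤ : ℕ∞) h)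
    (Ωt : Set E2) (hopen : IsOpen Ωt) (o₀ : E2) (ho₀ : o₀ ∈ Ωt)
    (hstar : StarConvex ℝ o₀ Ωt)
    (u : E2 → ℝ) (hu : ContDiff ℝ (⊤ : ℕ∞) u) :
    (∃ u₁ u₂ : E2 → ℝ, IsGraphInfIsom h Ωt u₁ u₂ u) ↔
    (∀ x ∈ Ωt,
      pd 0 (fun y => pd 1 (pd 1 h) y * pd 0 u y - pd 0 (pd 1 h) y * pd 1 u y) x +
      pd 1 (fun y => -(pd 0 (pd 1 h) y * pd 0 u y) + pd 0 (pd 0 h) y * pd 1 u y) x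
        = 0) := by
  have hh' := contDiff_pd hh
  have hu' := contDiff_pd hu
  have hf := ((hu' 0).mul (hh' 0)).neg
  have hg := ((hu' 1).mul (hh' 1)).neg
  have hk := (((hu' 0).mul (hh' 1)).add ((hu' 1).mul (hh' 0))).neg
  simp only [isGraphInfIsom_iff hu, div_cofactor_hessian_eq hh hu]
  constructor
  · rintro ⟨u₁, u₂, H⟩ x hx
    exact compatibility_of_symmetric_gradient hopen hf hg hk (fun y hy => (H y hy).1) (fun y hy => (H y hy).2.1)
      (fun y hy => (H y hy).2.2.1) (fun y hy => (H y hy).2.2.2.1)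
      (fun y hy => (H y hy).2.2.2.2) hx
  · exact fun H => exists_symmetric_gradient_eq hopen hstar hf hg hk H
end
end

section
/- Let μ > 0 and 2μ + λ > 0, and let Q₃(F) = 2μ|sym F|² + λ(tr F)² for F ∈ ℝ^{3×3} (the second differential at the identity of an isotropic stored energy). Fix a unit vector N ∈ ℝ³ with orthogonal plane P, and for a symmetric bilinear form G on P let F be any symmetric 3×3 matrix whose restriction to P is G. Then Q₂(G) := min_{a ∈ ℝ³} Q₃(F + a ⊗ N) = 2μ|G|² + (2μλ/(2μ+λ)) (tr G)², where |G|² and tr G are computed with respect to an orthonormal basis of P. -/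
noncomputable section

open Matrix

/-- `Q₃(F) = D²W(I)(F,F) = 2μ|sym F|² + λ(tr F)²` for an isotropic stored
energy density. -/
def Q3 (μ lam : ℝ) (F : Matrix (Fin 3) (Fin 3) ℝ) : ℝ :=
  2 * μ * (∑ i, ∑ j, ((1 / 2 : ℝ) * (F i j + F j i)) ^ 2) + lam * (Matrix.trace F) ^ 2

theorem Q3_eq_trace (μ lam : ℝ) (M : Matrix (Fin 3) (Fin 3) ℝ) :
    Q3 μ lam M = μ * (trace (M * Mᵀ) + trace (M * M)) + lam * trace M ^ 2 := by
  simp only [Q3, trace_fin_three, mul_apply, Fin.sum_univ_three, transpose_apply]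
  ring

theorem Q3_conj_of_transpose_mul_self (μ lam : ℝ) {R : Matrix (Fin 3) (Fin 3) ℝ}
    (hR : Rᵀ * R = 1) (M : Matrix (Fin 3) (Fin 3) ℝ) :
    Q3 μ lam (R * M * Rᵀ) = Q3 μ lam M := by
  have trace_conj (A : Matrix (Fin 3) (Fin 3) ℝ) : trace (R * A * Rᵀ) = trace A := by
    rw [trace_mul_cycle, hR, one_mul]
  have conj_mul (A B : Matrix (Fin 3) (Fin 3) ℝ) :
      R * A * Rᵀ * (R * B * Rᵀ) = R * (A * B) * Rᵀ := by
    calc R * A * Rᵀ * (R * B * Rᵀ) = R * A * (Rᵀ * R) * B * Rᵀ := by simp only [Matrix.mul_assoc]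
      _ = R * (A * B) * Rᵀ := by rw [hR, Matrix.mul_one, Matrix.mul_assoc R A B]
  have conj_transpose : (R * M * Rᵀ)ᵀ = R * Mᵀ * Rᵀ := by
    simp only [transpose_mul, transpose_transpose, Matrix.mul_assoc]
  rw [Q3_eq_trace, Q3_eq_trace, conj_transpose, conj_mul, conj_mul, trace_conj, trace_conj,
    trace_conj]

/-- Completing the square in the components of `c`, in a frame whose third vector is the normal. -/
theorem Q3_add_vecMulVec_eq_sum_sq {μ lam : ℝ} (hlam : 2 * μ + lam ≠ 0)
    {S : Matrix (Fin 3) (Fin 3) ℝ} (hS : S.IsSymm) (c : Fin 3 → ℝ) :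
    Q3 μ lam (S + vecMulVec c ![0, 0, 1]) =
      2 * μ * (S 0 0 ^ 2 + S 0 1 ^ 2 + S 1 0 ^ 2 + S 1 1 ^ 2) +
        2 * μ * lam / (2 * μ + lam) * (S 0 0 + S 1 1) ^ 2 +
        (4 * μ * ((S 0 2 + c 0 / 2) ^ 2 + (S 1 2 + c 1 / 2) ^ 2) +
          (2 * μ + lam) * (S 2 2 + c 2 + lam * (S 0 0 + S 1 1) / (2 * μ + lam)) ^ 2) := by
  simp only [Q3, trace_fin_three, Fin.sum_univ_three, Matrix.add_apply, vecMulVec_apply, cons_val,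
    hS.apply 0 1, hS.apply 0 2, hS.apply 1 2]
  field_simp
  ring

theorem mul_mul_transpose_apply_eq_dotProduct {n : Type*} [Fintype n] (R M : Matrix n n ℝ)
    (i j : n) : (R * M * Rᵀ) i j = R i ⬝ᵥ M *ᵥ R j := by
  rw [Matrix.mul_assoc]
  rfl

/-- Let `μ > 0`, `2μ + λ > 0`, `N` a unit vector with
orthogonal plane `P`, and `e₁, e₂` an orthonormal basis of `P`. For any
symmetric `F ∈ ℝ^{3×3}` with tangential part `G = F|_P`,
`Q₂(G) = min_{a∈ℝ³} Q₃(F + a ⊗ N) = 2μ|G|² + (2μλ/(2μ+λ))(tr G)²`. -/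
theorem statement_19 (μ lam : ℝ) (hμ : 0 < μ) (hlam : 0 < 2 * μ + lam)
    (N e₁ e₂ : Fin 3 → ℝ)
    (hN : N ⬝ᵥ N = 1) (he₁ : e₁ ⬝ᵥ e₁ = 1) (he₂ : e₂ ⬝ᵥ e₂ = 1)
    (h12 : e₁ ⬝ᵥ e₂ = 0) (h1N : e₁ ⬝ᵥ N = 0) (h2N : e₂ ⬝ᵥ N = 0)
    (F : Matrix (Fin 3) (Fin 3) ℝ) (hF : F.IsSymm) :
    IsLeast {q : ℝ | ∃ a : Fin 3 → ℝ, q = Q3 μ lam (F + Matrix.vecMulVec a N)}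
      (2 * μ * ((e₁ ⬝ᵥ F.mulVec e₁) ^ 2 + (e₁ ⬝ᵥ F.mulVec e₂) ^ 2 +
          (e₂ ⬝ᵥ F.mulVec e₁) ^ 2 + (e₂ ⬝ᵥ F.mulVec e₂) ^ 2) +
        (2 * μ * lam / (2 * μ + lam)) *
          (e₁ ⬝ᵥ F.mulVec e₁ + e₂ ⬝ᵥ F.mulVec e₂) ^ 2) := by
  set R : Matrix (Fin 3) (Fin 3) ℝ := of ![e₁, e₂, N]
  have hRRt : R * Rᵀ = 1 := by
    ext i j
    change ![e₁, e₂, N] i ⬝ᵥ ![e₁, e₂, N] j = _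
    fin_cases i <;> fin_cases j <;>
      simp [hN, he₁, he₂, h12, h1N, h2N, dotProduct_comm e₂ e₁, dotProduct_comm N e₁,
        dotProduct_comm N e₂]
  have hRtR : Rᵀ * R = 1 := mul_eq_one_comm.mp hRRt
  have hRN : R *ᵥ N = ![0, 0, 1] := by
    ext i
    change ![e₁, e₂, N] i ⬝ᵥ N = _
    fin_cases i <;> simp [hN, h1N, h2N]
  set S := R * F * Rᵀ with hS
  have hSsymm : S.IsSymm := by
    simp only [IsSymm, hS, transpose_mul, transpose_transpose, hF.eq, Matrix.mul_assoc]
  have hQ (a : Fin 3 → ℝ) : Q3 μ lam (F + vecMulVec a N) =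
      Q3 μ lam (S + vecMulVec (R *ᵥ a) ![0, 0, 1]) := by
    rw [← Q3_conj_of_transpose_mul_self μ lam hRtR, Matrix.mul_add, Matrix.add_mul,
      mul_vecMulVec, vecMulVec_mul, vecMul_transpose, hRN]
  have h00 : e₁ ⬝ᵥ F *ᵥ e₁ = S 0 0 := (mul_mul_transpose_apply_eq_dotProduct R F 0 0).symm
  have h01 : e₁ ⬝ᵥ F *ᵥ e₂ = S 0 1 := (mul_mul_transpose_apply_eq_dotProduct R F 0 1).symm
  have h10 : e₂ ⬝ᵥ F *ᵥ e₁ = S 1 0 := (mul_mul_transpose_apply_eq_dotProduct R F 1 0).symm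
  have h11 : e₂ ⬝ᵥ F *ᵥ e₂ = S 1 1 := (mul_mul_transpose_apply_eq_dotProduct R F 1 1).symm
  rw [h00, h01, h10, h11]
  constructor
  · refine ⟨Rᵀ *ᵥ ![-2 * S 0 2, -2 * S 1 2,
      -S 2 2 - lam * (S 0 0 + S 1 1) / (2 * μ + lam)], ?_⟩
    rw [hQ, mulVec_mulVec, hRRt, one_mulVec, Q3_add_vecMulVec_eq_sum_sq hlam.ne' hSsymm]
    simp only [cons_val]
    ring
  · rintro _ ⟨a, rfl⟩
    rw [hQ, Q3_add_vecMulVec_eq_sum_sq hlam.ne' hSsymm]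
    exact le_add_of_nonneg_right (by positivity)
end
end
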